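/- Let R be an integral domain. Then R is a PvMD if and only if every pure w-injective divisible R-module is injective. -/

import Mathlib

open TensorProduct

/-- A finitely generated ideal `J` is a GV-ideal if the natural map
`R → Hom_R(J, R)`, sending `r` to multiplication by `r`, is bijective. -/
def IsGVIdeal {R : Type*} [CommRing R] (J : Ideal R) : Prop :=
  J.FG ∧ Function.Bijective fun r : R => (r • J.subtype : J →ₗ[R] R)

/-- An element `m` of an `R`-module is a GV-torsion element if it is
annihilated by some GV-ideal. -/
def IsGVTorsionElem (R : Type*) [CommRing R] {M : Type*} [AddCommGroup M] [Module R M]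
    (m : M) : Prop :=
  ∃ J : Ideal R, IsGVIdeal J ∧ ∀ j ∈ J, j • m = 0

/-- An `R`-module `E` is pure `w`-injective if it is injective with respect to all
`w`-pure `w`-monomorphisms. -/
def IsPureWInjective (R : Type u) [CommRing R] (E : Type u) [AddCommGroup E]
    [Module R E] : Prop :=
  ∀ (N M : Type u) [AddCommGroup N] [Module R N] [AddCommGroup M] [Module R M]
    (f : N →ₗ[R] M),
    (∀ x ∈ LinearMap.ker f, IsGVTorsionElem R x) →
    (∀ (L : Type u) [AddCommGroup L] [Module R L],
      ∀ x ∈ LinearMap.ker (LinearMap.lTensor L f), IsGVTorsionElem R x) →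
    ∀ g : N →ₗ[R] E, ∃ h : M →ₗ[R] E, h ∘ₗ f = g

/-- `R` is a PvMD if for every nonzero finitely generated ideal `I` of `R` there is a
GV-ideal `J` with `J ⊆ I·I⁻¹` (inside the quotient field `K`). -/
def IsPvMD (R : Type*) [CommRing R] [IsDomain R] (K : Type*) [Field K] [Algebra R K]
    [IsFractionRing R K] : Prop :=
  ∀ I : Ideal R, I ≠ ⊥ → I.FG →
    ∃ J : Ideal R, IsGVIdeal J ∧
      (J : FractionalIdeal (nonZeroDivisors R) K) ≤
        (I : FractionalIdeal (nonZeroDivisors R) K) *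
          (I : FractionalIdeal (nonZeroDivisors R) K)⁻¹

section GVIdeal

variable {R : Type*} [CommRing R]

theorem isGVIdeal_iff {J : Ideal R} :
    IsGVIdeal J ↔ J.FG ∧ (∀ r : R, (∀ j ∈ J, r * j = 0) → r = 0) ∧
      ∀ φ : J →ₗ[R] R, ∃ r : R, ∀ j : J, φ j = r * j := by
  refine and_congr_right fun _ => and_congr ⟨fun h r hr => ?_, fun h r s hrs => ?_⟩
    ⟨fun h φ => ?_, fun h φ => ?_⟩
  · refine h (a₁ := r) (a₂ := 0) (LinearMap.ext fun j => ?_)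
    simpa using hr j j.2
  · refine sub_eq_zero.1 (h _ fun j hj => ?_)
    have := LinearMap.congr_fun hrs ⟨j, hj⟩
    simp only [LinearMap.smul_apply, Submodule.subtype_apply, smul_eq_mul] at this
    rw [sub_mul, this, sub_self]
  · obtain ⟨r, rfl⟩ := h φ
    exact ⟨r, fun j => rfl⟩
  · obtain ⟨r, hr⟩ := h φ
    exact ⟨r, LinearMap.ext fun j => (hr j).symm⟩

theorem isGVIdeal_top : IsGVIdeal (⊤ : Ideal R) := by
  refine isGVIdeal_iff.2 ⟨⟨{1}, by simp⟩, fun r hr => by simpa using hr 1 trivial,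
    fun φ => ⟨φ ⟨1, trivial⟩, fun j => ?_⟩⟩
  rw [mul_comm, ← smul_eq_mul, ← map_smul]
  congr 1
  ext
  simp

theorem IsGVIdeal.mul {I J : Ideal R} (hI : IsGVIdeal I) (hJ : IsGVIdeal J) :
    IsGVIdeal (I * J) := by
  obtain ⟨hIfg, hI0, hIφ⟩ := isGVIdeal_iff.1 hI
  obtain ⟨hJfg, hJ0, hJφ⟩ := isGVIdeal_iff.1 hJ
  refine isGVIdeal_iff.2 ⟨hIfg.mul hJfg, fun r hr => ?_, fun φ => ?_⟩
  · refine hI0 r fun i hi => hJ0 _ fun j hj => ?_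
    rw [mul_assoc]
    exact hr _ (Ideal.mul_mem_mul hi hj)
  · have key : ∀ i : I, ∃ r : R, ∀ j : J,
        φ ⟨i * j, Ideal.mul_mem_mul i.2 j.2⟩ = r * j := fun i => by
      obtain ⟨r, hr⟩ := hJφ (φ ∘ₗ LinearMap.codRestrict (I * J)
        ((i : R) • J.subtype) fun j => Ideal.mul_mem_mul i.2 j.2)
      exact ⟨r, fun j => by rw [← hr j]; rfl⟩
    choose ψ hψ using key
    let ψ' : I →ₗ[R] R :=
      { toFun := ψ
        map_add' := fun a b => by
          refine sub_eq_zero.1 (hJ0 _ fun j hj => ?_)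
          have h := hψ (a + b) ⟨j, hj⟩
          rw [sub_mul, add_mul, ← h, ← hψ a ⟨j, hj⟩, ← hψ b ⟨j, hj⟩, ← map_add, sub_eq_zero]
          congr 1
          ext
          simp [add_mul]
        map_smul' := fun r a => by
          refine sub_eq_zero.1 (hJ0 _ fun j hj => ?_)
          have h := hψ (r • a) ⟨j, hj⟩
          rw [RingHom.id_apply, sub_mul, smul_eq_mul, mul_assoc, ← h, ← hψ a ⟨j, hj⟩,
            ← smul_eq_mul (a := r), ← map_smul, sub_eq_zero]
          congr 1
          ext
          simp [mul_assoc] }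
    obtain ⟨r, hr⟩ := hIφ ψ'
    refine ⟨r, fun x => ?_⟩
    have h : ∀ x (hx : x ∈ I * J), φ ⟨x, hx⟩ = r * x := fun x hx => by
      induction hx using Submodule.mul_induction_on' with
      | mem_mul_mem i hi j hj =>
        have h1 : ψ ⟨i, hi⟩ = r * i := hr ⟨i, hi⟩
        have h2 := hψ ⟨i, hi⟩ ⟨j, hj⟩
        rw [h1, mul_assoc] at h2
        exact h2
      | add x hx y hy h1 h2 =>
        rw [mul_add, ← h1, ← h2, ← map_add]
        rfl
    exact h x x.2

theorem IsGVIdeal.prod {ι : Type*} (s : Finset ι) {J : ι → Ideal R}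
    (h : ∀ i ∈ s, IsGVIdeal (J i)) : IsGVIdeal (∏ i ∈ s, J i) :=
  Finset.prod_induction J IsGVIdeal (fun _ _ => IsGVIdeal.mul) 
    (by rw [Ideal.one_eq_top]; exact isGVIdeal_top) h

/-- The elements `x` of `R` whose class in `R ⧸ T` is GV-torsion. -/
def gvClosure (T : Ideal R) : Ideal R where
  carrier := {x | ∃ J : Ideal R, IsGVIdeal J ∧ ∀ r ∈ J, r * x ∈ T}
  zero_mem' := ⟨⊤, isGVIdeal_top, fun r _ => by rw [mul_zero]; exact T.zero_mem⟩
  add_mem' := by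
    intro x y hx hy
    obtain ⟨I, hI, hx⟩ := Set.mem_ofPred.1 hx
    obtain ⟨J, hJ, hy⟩ := Set.mem_ofPred.1 hy
    refine ⟨I * J, hI.mul hJ, fun r hr => ?_⟩
    rw [mul_add]
    exact T.add_mem (hx r (Ideal.mul_le_left hr)) (hy r (Ideal.mul_le_right hr))
  smul_mem' := by
    rintro c x ⟨I, hI, hx⟩
    refine ⟨I, hI, fun r hr => ?_⟩
    rw [smul_eq_mul, mul_left_comm]
    exact T.mul_mem_left _ (hx r hr)

theorem exists_isGVIdeal_le_of_le_gvClosure {J T : Ideal R} (hJ : IsGVIdeal J)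
    (h : J ≤ gvClosure T) : ∃ I : Ideal R, IsGVIdeal I ∧ I ≤ T := by
  classical
  obtain ⟨s, hs⟩ := hJ.1
  have h' : ∀ x : R, ∃ I : Ideal R, IsGVIdeal I ∧ (x ∈ s → ∀ r ∈ I, r * x ∈ T) := fun x => by
    by_cases hx : x ∈ s
    · obtain ⟨I, hI, hr⟩ := h (hs ▸ Submodule.subset_span hx : x ∈ J)
      exact ⟨I, hI, fun _ => hr⟩
    · exact ⟨⊤, isGVIdeal_top, fun h => absurd h hx⟩
  choose I hI hIT using h'
  refine ⟨J * ∏ x ∈ s, I x, hJ.mul (.prod s fun x _ => hI x), ?_⟩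
  refine Ideal.mul_le.2 fun x hx r hr => ?_
  rw [← hs] at hx
  induction hx using Submodule.span_induction with
  | mem x hx =>
    rw [mul_comm]
    exact hIT x hx r (Ideal.prod_le_inf.trans (Finset.inf_le hx) hr)
  | zero => simp
  | add x y _ _ hx hy =>
    rw [add_mul]
    exact T.add_mem hx hy
  | smul a x _ hx =>
    rw [smul_eq_mul, mul_assoc]
    exact T.mul_mem_left _ hx

theorem exists_prime_of_forall_not_isGVIdeal_le {T : Ideal R}
    (hT : ∀ J : Ideal R, IsGVIdeal J → ¬ J ≤ T) :
    ∃ p : Ideal R, p.IsPrime ∧ T ≤ p ∧ ∀ J : Ideal R, IsGVIdeal J → ¬ J ≤ p := by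
  obtain ⟨p, hTp, hp⟩ := zorn_le_nonempty₀ {I : Ideal R | ∀ J : Ideal R, IsGVIdeal J → ¬ J ≤ I}
    (fun c hc hchain y hy => ⟨sSup c, fun J hJ hle => by
      obtain ⟨I, hI, hJI⟩ := (CompleteLattice.isCompactElement_iff_le_of_directed_sSup_le _ J).1
        ((Submodule.fg_iff_compact J).1 hJ.1) c ⟨y, hy⟩ hchain.directedOn hle
      exact hc hI J hJ hJI, fun z hz => le_sSup hz⟩) T hT
  have hex : ∀ x ∉ p, ∃ J : Ideal R, IsGVIdeal J ∧ J ≤ p ⊔ Ideal.span {x} := fun x hx => by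
    by_contra! hcon
    exact hx (hp.2 hcon le_sup_left
      (Ideal.mem_sup_right (Ideal.mem_span_singleton_self x)))
  refine ⟨p, ⟨fun h => hp.1 ⊤ isGVIdeal_top h.ge, fun {x y} hxy => ?_⟩, hTp, hp.1⟩
  by_contra! hcon
  obtain ⟨I, hI, hIp⟩ := hex x hcon.1
  obtain ⟨J, hJ, hJp⟩ := hex y hcon.2
  refine hp.1 _ (hI.mul hJ) ((Ideal.mul_mono hIp hJp).trans ?_)
  rw [Ideal.sup_mul, Ideal.mul_sup (Ideal.span {x}), Ideal.span_singleton_mul_span_singleton]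
  refine sup_le Ideal.mul_le_left (sup_le Ideal.mul_le_right ?_)
  simpa [Ideal.span_singleton_le_iff_mem] using hxy

end GVIdeal

section Divisible

variable {R : Type*} [CommRing R] {E : Type*} [AddCommGroup E] [Module R E]
  {ι κ : Type*} [Fintype κ]

/-- The scalars `r` for which the linear system `A x = r • e`, restricted to the rows in `s`, has a
solution in `E`. -/
def solvableScalars (s : Finset ι) (A : ι → κ → R) (e : ι → E) : Ideal R where
  carrier := {r | ∃ x : κ → E, ∀ i ∈ s, r • e i = ∑ j, A i j • x j}
  zero_mem' := ⟨0, by simp⟩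
  add_mem' := by
    intro a b ha hb
    obtain ⟨x, hx⟩ := Set.mem_ofPred.1 ha
    obtain ⟨y, hy⟩ := Set.mem_ofPred.1 hb
    exact ⟨x + y, fun i hi => by
      simp [add_smul, hx i hi, hy i hi, Finset.sum_add_distrib]⟩
  smul_mem' := by
    rintro c a ⟨x, hx⟩
    exact ⟨c • x, fun i hi => by
      simp [mul_smul, hx i hi, Finset.smul_sum, smul_comm c]⟩

/-- One step of Gaussian elimination with pivot `A i j`, where `c` is a multiple of `A i j` and
`b k / c = A k j / A i j`. -/
theorem mul_mem_solvableScalars [IsDomain R] [DecidableEq ι]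
    (hdiv : ∀ r : R, r ≠ 0 → ∀ e : E, ∃ e' : E, r • e' = e)
    {s : Finset ι} {A : ι → κ → R} {e : ι → E} {i : ι} {j : κ} (hA : A i j ≠ 0) {c : R}
    {b : ι → R} (hb : ∀ k ∈ s, c * A k j = b k * A i j) {r : R}
    (hr : r ∈ solvableScalars (s.erase i) (fun k l => c * A k l - b k * A i l)
      fun k => c • e k - b k • e i) :
    r * c ∈ solvableScalars s A e := by
  classical
  obtain ⟨x, hx⟩ := hr
  obtain ⟨z, hz⟩ := hdiv (A i j) hA (r • e i - ∑ l ∈ Finset.univ.erase j, A i l • x l)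
  set y : κ → E := Function.update x j z with hy
  have hyl : ∀ l, l ≠ j → y l = x l := fun l hl => Function.update_of_ne hl _ _
  have hi : r • e i = ∑ l, A i l • y l := by
    rw [← Finset.add_sum_erase _ _ (Finset.mem_univ j),
      Finset.sum_congr rfl fun l hl => by rw [hyl l (Finset.ne_of_mem_erase hl)],
      hy, Function.update_self, hz, sub_add_cancel]
  refine ⟨c • y, fun k hk => ?_⟩
  by_cases hki : k = i
  · subst hki
    simp [mul_comm r c, mul_smul, hi, Finset.smul_sum, smul_comm c]
  have h1 := hx k (Finset.mem_erase.2 ⟨hki, hk⟩)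
  have h2 : ∑ l, (c * A k l - b k * A i l) • x l = ∑ l, (c * A k l - b k * A i l) • y l := by
    refine Finset.sum_congr rfl fun l _ => ?_
    by_cases hl : l = j
    · rw [hl, hb k hk, sub_self, zero_smul, zero_smul]
    · rw [hyl l hl]
  have h3 : ∑ l, (c * A k l - b k * A i l) • y l =
      ∑ l, A k l • (c • y) l - b k • r • e i := by
    rw [hi, Finset.smul_sum, ← Finset.sum_sub_distrib]
    refine Finset.sum_congr rfl fun l _ => ?_
    rw [sub_smul, Pi.smul_apply, mul_smul, mul_smul, smul_comm c]
  rw [h2, h3, smul_sub, smul_comm r (b k), sub_left_inj, smul_smul] at h1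
  exact h1

theorem IsPvMD.exists_isGVIdeal_le_solvableScalars [IsDomain R]
    {K : Type*} [Field K] [Algebra R K] [IsFractionRing R K] (hR : IsPvMD R K)
    {M : Type*} [AddCommGroup M] [Module R M]
    (hdiv : ∀ r : R, r ≠ 0 → ∀ e : E, ∃ e' : E, r • e' = e)
    {f : E →ₗ[R] M} (hf : Function.Injective f) (s : Finset ι) :
    ∀ (A : ι → κ → R) (e : ι → E) (m : κ → M), (∀ i ∈ s, f (e i) = ∑ j, A i j • m j) →
      ∃ J : Ideal R, IsGVIdeal J ∧ J ≤ solvableScalars s A e := by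
  classical
  induction s using Finset.strongInduction with
  | H s ih =>
  intro A e m h
  set I : Ideal R := Ideal.span ((fun p : ι × κ => A p.1 p.2) '' (s ×ˢ Finset.univ)) with hI
  have hmem : ∀ i ∈ s, ∀ j, A i j ∈ I := fun i hi j =>
    Ideal.subset_span ⟨(i, j), by simpa using hi, rfl⟩
  by_cases hI0 : I = ⊥
  · refine ⟨⊤, isGVIdeal_top, fun r _ => ⟨0, fun i hi => ?_⟩⟩
    have hA : ∀ j, A i j = 0 := fun j => by simpa [hI0] using hmem i hi j
    have : e i = 0 := hf (by simp [h i hi, hA])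
    simp [this]
  have hI0' : (I : FractionalIdeal (nonZeroDivisors R) K) ≠ 0 :=
    FractionalIdeal.coeIdeal_ne_zero.2 hI0
  obtain ⟨J, hJ, hJI⟩ := hR I hI0 (Submodule.fg_span
    ((s.finite_toSet.prod Finset.univ.finite_toSet).image _))
  refine exists_isGVIdeal_le_of_le_gvClosure hJ ?_
  rw [← FractionalIdeal.coeIdeal_le_coeIdeal K]
  refine hJI.trans (FractionalIdeal.mul_le.2 fun a' ha' y hy => ?_)
  rw [FractionalIdeal.mem_inv_iff hI0'] at hy
  obtain ⟨a, ha, rfl⟩ := (FractionalIdeal.mem_coeIdeal _).1 ha'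
  clear ha'
  induction ha using Submodule.span_induction with
  | zero => simp
  | add a b _ _ ha hb =>
    rw [map_add, add_mul]
    exact Submodule.add_mem _ ha hb
  | smul r a _ ha =>
    rw [smul_eq_mul, map_mul, mul_assoc, ← Algebra.smul_def]
    exact Submodule.smul_mem _ r ha
  | mem a ha =>
    obtain ⟨⟨i, j⟩, hij, rfl⟩ := ha
    have hi : i ∈ s := by simpa using hij
    have hb : ∀ k, ∃ b : R, k ∈ s → algebraMap R K b = y * algebraMap R K (A k j) := fun k => by
      by_cases hk : k ∈ s
      · obtain ⟨b, hb⟩ := (FractionalIdeal.mem_one_iff _).1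
          (hy _ (FractionalIdeal.mem_coeIdeal_of_mem _ (hmem k hk j)))
        exact ⟨b, fun _ => hb⟩
      · exact ⟨0, fun h => absurd h hk⟩
    choose b hb using hb
    refine (FractionalIdeal.mem_coeIdeal _).2 ⟨b i, ?_, by rw [hb i hi, mul_comm]⟩
    by_cases hA : A i j = 0
    · have : b i = 0 := IsFractionRing.injective R K (by simp [hb i hi, hA])
      rw [this]
      exact Submodule.zero_mem _
    have hbA : ∀ k ∈ s, b i * A k j = b k * A i j := fun k hk =>
      IsFractionRing.injective R K (by
        rw [map_mul, map_mul, hb i hi, hb k hk]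
        ring)
    obtain ⟨J', hJ', hle⟩ := ih (s.erase i) (Finset.erase_ssubset hi)
      (fun k l => b i * A k l - b k * A i l) (fun k => b i • e k - b k • e i) m fun k hk => by
        rw [map_sub, map_smul, map_smul, h k (Finset.mem_of_mem_erase hk), h i hi,
          Finset.smul_sum, Finset.smul_sum, ← Finset.sum_sub_distrib]
        exact Finset.sum_congr rfl fun l _ => by rw [sub_smul, mul_smul, mul_smul]
    exact ⟨J', hJ', fun r hr => mul_mem_solvableScalars hdiv hA hbA (hle hr)⟩

theorem IsPvMD.isGVTorsionElem_of_lTensor_eq_zero [IsDomain R]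
    {K : Type*} [Field K] [Algebra R K] [IsFractionRing R K] (hR : IsPvMD R K)
    {M : Type*} [AddCommGroup M] [Module R M]
    (hdiv : ∀ r : R, r ≠ 0 → ∀ e : E, ∃ e' : E, r • e' = e)
    {f : E →ₗ[R] M} (hf : Function.Injective f) {L : Type*} [AddCommGroup L] [Module R L]
    {x : L ⊗[R] E} (hx : LinearMap.lTensor L f x = 0) : IsGVTorsionElem R x := by
  classical
  set π : (L →₀ R) →ₗ[R] L := Finsupp.linearCombination R id
  have hπs : Function.Surjective π := Finsupp.linearCombination_id_surjective R L
  obtain ⟨u, rfl⟩ := LinearMap.rTensor_surjective E hπs x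
  have hu : LinearMap.lTensor (L →₀ R) f u ∈
      LinearMap.range (LinearMap.rTensor M (LinearMap.ker π).subtype) := by
    refine (rTensor_exact (M := ↥(LinearMap.ker π)) M (LinearMap.exact_subtype_ker_map π) hπs _).1 ?_
    rw [← LinearMap.comp_apply, LinearMap.rTensor_comp_lTensor, ← LinearMap.lTensor_comp_rTensor]
    exact hx
  obtain ⟨w, hw⟩ := hu
  obtain ⟨t, rfl⟩ := TensorProduct.exists_finset w
  set φE := TensorProduct.finsuppScalarLeft R E L
  set φM := TensorProduct.finsuppScalarLeft R M L
  have hφ : ∀ v l, φM (LinearMap.lTensor (L →₀ R) f v) l = f (φE v l) := fun v l => by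
    induction v using TensorProduct.induction_on with
    | zero => simp
    | tmul p n => simp [φE, φM, TensorProduct.finsuppScalarLeft_apply_tmul_apply]
    | add a b ha hb => simp [ha, hb]
  have hsys : ∀ l, f (φE u l) = ∑ k : t, (k.1.1 : L →₀ R) l • k.1.2 := fun l => by
    rw [← hφ, ← hw]
    simp [φM, Finsupp.finsetSum_apply, TensorProduct.finsuppScalarLeft_apply_tmul_apply,
      Finset.sum_attach t fun k => (k.1 : L →₀ R) l • k.2]
  set s : Finset L := (φE u).support ∪ t.biUnion fun k => (k.1 : L →₀ R).support with hs
  obtain ⟨J, hJ, hle⟩ := hR.exists_isGVIdeal_le_solvableScalars hdiv hf s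
    (fun l (k : t) => (k.1.1 : L →₀ R) l) (fun l => φE u l) (fun k => k.1.2) fun l _ => hsys l
  refine ⟨J, hJ, fun r hr => ?_⟩
  obtain ⟨y, hy⟩ := hle hr
  have hru : r • u = ∑ k : t, (k.1.1 : L →₀ R) ⊗ₜ[R] y k := by
    refine φE.injective (Finsupp.ext fun l => ?_)
    have : r • φE u l = ∑ k : t, (k.1.1 : L →₀ R) l • y k := by
      by_cases hl : l ∈ s
      · exact hy l hl
      · simp only [hs, Finset.mem_union, Finset.mem_biUnion, not_or, not_exists, not_and,
          Finsupp.notMem_support_iff] at hl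
        rw [hl.1, smul_zero, Finset.sum_eq_zero fun k _ => by rw [hl.2 k k.2, zero_smul]]
    simp [this, φE, Finsupp.finsetSum_apply, TensorProduct.finsuppScalarLeft_apply_tmul_apply]
  rw [← map_smul, hru, map_sum]
  refine Finset.sum_eq_zero fun k _ => ?_
  rw [LinearMap.rTensor_tmul, LinearMap.mem_ker.1 k.1.1.2, TensorProduct.zero_tmul]

end Divisible

section TorsionFree

variable {R : Type u} [CommRing R]

theorem module_injective_of_isPureWInjective
    {E : Type u} [AddCommGroup E] [Module R E] (hE : IsPureWInjective R E)
    (hpure : ∀ (M : Type u) [AddCommGroup M] [Module R M] (f : E →ₗ[R] M), Function.Injective f →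
      ∀ (L : Type u) [AddCommGroup L] [Module R L],
        ∀ x ∈ LinearMap.ker (LinearMap.lTensor L f), IsGVTorsionElem R x) :
    Module.Injective R E := by
  let I : ModuleCat.{u} R := CategoryTheory.Injective.under (ModuleCat.of R E)
  let i : E →ₗ[R] I := (CategoryTheory.Injective.ι (ModuleCat.of R E)).hom
  have hi : Function.Injective i := (ModuleCat.mono_iff_injective _).1 inferInstance
  have hI : Module.Injective R I :=
    (Module.injective_iff_injective_object R I).2
      (inferInstanceAs (CategoryTheory.Injective (CategoryTheory.Injective.under _)))
  obtain ⟨ρ, hρ⟩ := hE E I i (fun x hx => ⟨⊤, isGVIdeal_top, fun r _ => by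
    rw [LinearMap.ker_eq_bot.2 hi, Submodule.mem_bot] at hx
    rw [hx, smul_zero]⟩) (hpure I i hi) LinearMap.id
  refine ⟨fun X Y _ _ _ _ f hf g => ?_⟩
  obtain ⟨h, hh⟩ := hI.out f hf (i ∘ₗ g)
  exact ⟨ρ ∘ₗ h, fun x => by
    rw [LinearMap.comp_apply, hh]
    exact LinearMap.congr_fun hρ (g x)⟩

variable {S : Type u} [CommRing S] [Algebra R S] {F : Type u} [AddCommGroup F] [Module R F]
  [Module S F] [IsScalarTower R S F]

/-- If every GV-ideal of `R` generates the unit ideal in an `R`-algebra `S`, in the strong sense that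
it contains an element which becomes a unit, then character modules of `S`-modules are pure
`w`-injective. -/
theorem isPureWInjective_characterModule
    (hS : ∀ J : Ideal R, IsGVIdeal J → ∃ j ∈ J, IsUnit (algebraMap R S j)) :
    IsPureWInjective R (CharacterModule F) := by
  intro N M _ _ _ _ f _ hf
  refine rTensor_injective_iff_lcomp_surjective.1 ?_
  rw [← LinearMap.lTensor_inj_iff_rTensor_inj]
  refine (injective_iff_map_eq_zero _).2 fun x hx => ?_
  obtain ⟨J, hJ, hx⟩ := hf F x hx
  obtain ⟨j, hj, hu⟩ := hS J hJ
  have h : algebraMap R S j • x = 0 := by rw [algebraMap_smul, hx j hj]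
  exact hu.smul_eq_zero.1 h

theorem flat_of_forall_isPureWInjective_divisible
    (H : ∀ (E : Type u) [AddCommGroup E] [Module R E], IsPureWInjective R E →
      (∀ r : R, r ≠ 0 → ∀ e : E, ∃ e' : E, r • e' = e) → Module.Injective R E)
    (hS : ∀ J : Ideal R, IsGVIdeal J → ∃ j ∈ J, IsUnit (algebraMap R S j))
    (hF : ∀ r : R, r ≠ 0 → ∀ x : F, r • x = 0 → x = 0) : Module.Flat R F := by
  refine Module.Flat.iff_characterModule_injective.2
    (H _ (isPureWInjective_characterModule (S := S) hS) fun r hr c => ?_)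
  obtain ⟨c', hc⟩ := CharacterModule.dual_surjective_of_injective (LinearMap.lsmul R F r)
    ((injective_iff_map_eq_zero _).2 fun x hx => hF r hr x hx) c
  exact ⟨c', hc⟩

end TorsionFree

theorem Ideal.isPrincipal_of_flat_of_fg {R : Type*} [CommRing R] [IsLocalRing R]
    {I : Ideal R} (hI : I.FG)   [Module.Flat R I] : I.IsPrincipal := by
  have : Module.Finite R I := Module.Finite.iff_fg.2 hI
  have : Module.Free R I := Module.free_of_flat_of_isLocalRing
  exact (Submodule.rank_le_one_iff_isPrincipal I).1 ((Submodule.rank_le I).trans (Module.rank_self R).le)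

section Localization

variable {R : Type*} [CommRing R] [IsDomain R]

/-- A finitely generated ideal which is principal at the prime `p` divides, up to an element
outside `p`, one of its members. -/
theorem Ideal.exists_dvd_mul_of_isPrincipal_map {p I : Ideal R} [p.IsPrime] (hI : I.FG)
    (h : (I.map (algebraMap R (Localization.AtPrime p))).IsPrincipal) :
    ∃ a ∈ I, ∃ s ∉ p, ∀ x ∈ I, a ∣ s * x := by
  classical
  set S := Localization.AtPrime p
  obtain ⟨g, hg⟩ := h
  have hgI : g ∈ I.map (algebraMap R S) := by
    rw [hg]
    exact Submodule.mem_span_singleton_self g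
  obtain ⟨⟨a, v⟩, hav⟩ := (IsLocalization.mem_map_algebraMap_iff p.primeCompl S).1 hgI
  dsimp only at hav
  have key : ∀ x : R, ∃ s : R, s ∉ p ∧ (x ∈ I → (a : R) ∣ s * x) := fun x => by
    by_cases hx : x ∈ I
    · have hxg := Ideal.mem_map_of_mem (algebraMap R S) hx
      rw [hg] at hxg
      obtain ⟨t, ht⟩ := Submodule.mem_span_singleton.1 hxg
      obtain ⟨⟨r, w⟩, hrw⟩ := IsLocalization.surj p.primeCompl t
      dsimp only at hrw
      refine ⟨v * w, (v * w).2, fun _ => ⟨r, IsLocalization.injective S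
        p.primeCompl_le_nonZeroDivisors ?_⟩⟩
      rw [map_mul, map_mul, map_mul, ← ht, ← hav, ← hrw, smul_eq_mul]
      ring
    · exact ⟨1, p.ne_top_iff_one.1 Ideal.IsPrime.ne_top', fun h => absurd h hx⟩
  choose s hs hsI using key
  obtain ⟨G, hG⟩ := hI
  refine ⟨a, a.2, ∏ x ∈ G, s x, fun hp => ?_, fun x hx => ?_⟩
  · obtain ⟨x, _, hx⟩ := (Ideal.IsPrime.prod_mem_iff).1 hp
    exact hs x hx
  · rw [← hG] at hx
    induction hx using Submodule.span_induction with
    | mem x hx =>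
      exact (hsI x (hG ▸ Submodule.subset_span hx)).trans
        (mul_dvd_mul_right (Finset.dvd_prod_of_mem s hx) x)
    | zero => simp
    | add x y _ _ hx hy =>
      rw [mul_add]
      exact dvd_add hx hy
    | smul c x _ hx =>
      rw [smul_eq_mul, mul_left_comm]
      exact hx.mul_left c

variable {K : Type*} [Field K] [Algebra R K] [IsFractionRing R K]

theorem algebraMap_mem_mul_inv {I : Ideal R} (hI : I ≠ ⊥) {a s : R} (ha : a ∈ I) (hs : s ≠ 0)
    (h : ∀ x ∈ I, a ∣ s * x) : algebraMap R K s ∈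
      (I : FractionalIdeal (nonZeroDivisors R) K) *
        (I : FractionalIdeal (nonZeroDivisors R) K)⁻¹ := by
  obtain ⟨x, hx, hx0⟩ := Submodule.exists_mem_ne_zero_of_ne_bot hI
  have ha0 : a ≠ 0 := by
    rintro rfl
    exact mul_ne_zero hs hx0 (zero_dvd_iff.1 (h x hx))
  have haK : algebraMap R K a ≠ 0 := by simpa using ha0
  rw [← mul_div_cancel₀ (algebraMap R K s) haK]
  refine FractionalIdeal.mul_mem_mul (FractionalIdeal.mem_coeIdeal_of_mem _ ha) ?_
  rw [FractionalIdeal.mem_inv_iff (FractionalIdeal.coeIdeal_ne_zero.2 hI)]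
  intro y' hy'
  obtain ⟨y, hy, rfl⟩ := (FractionalIdeal.mem_coeIdeal _).1 hy'
  obtain ⟨z, hz⟩ := h y hy
  refine (FractionalIdeal.mem_one_iff _).2 ⟨z, ?_⟩
  rw [div_mul_eq_mul_div, ← map_mul, hz, map_mul, mul_div_cancel_left₀ _ haK]

/-- A criterion for being a PvMD: all finitely generated ideals are principal at the primes which
contain no GV-ideal. -/
theorem isPvMD_of_isPrincipal_map
    (h : ∀ I : Ideal R, I.FG → ∀ (p : Ideal R) [p.IsPrime],
      (∀ J : Ideal R, IsGVIdeal J → ¬ J ≤ p) →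
        (I.map (algebraMap R (Localization.AtPrime p))).IsPrincipal) :
    IsPvMD R K := by
  intro I hI hfg
  set Q : FractionalIdeal (nonZeroDivisors R) K :=
    (I : FractionalIdeal (nonZeroDivisors R) K) * (I : FractionalIdeal (nonZeroDivisors R) K)⁻¹
  let T : Ideal R := (Q : Submodule R K).comap (Algebra.linearMap R K)
  by_contra! hcon
  obtain ⟨p, hp, hTp, hpGV⟩ := exists_prime_of_forall_not_isGVIdeal_le (T := T) fun J hJ hJT =>
    hcon J hJ fun x hx => by
      obtain ⟨y, hy, rfl⟩ := (FractionalIdeal.mem_coeIdeal _).1 hx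
      exact hJT hy
  obtain ⟨a, ha, s, hs, hdvd⟩ := Ideal.exists_dvd_mul_of_isPrincipal_map hfg (h I hfg p hpGV)
  refine hs (hTp ?_)
  exact algebraMap_mem_mul_inv (K := K) hI ha (fun h0 => hs (h0 ▸ p.zero_mem)) hdvd

end Localization

/-- `R` is a PvMD iff every pure `w`-injective divisible `R`-module is
injective. -/
theorem pvmd_iff_pureWInjective_divisible_injective
    {R : Type u} [CommRing R] [IsDomain R] :
    IsPvMD R (FractionRing R) ↔
      ∀ (E : Type u) [AddCommGroup E] [Module R E],
        IsPureWInjective R E →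
        (∀ (r : R), r ≠ 0 → ∀ e : E, ∃ e' : E, r • e' = e) →
        ∀ (N M : Type u) [AddCommGroup N] [Module R N] [AddCommGroup M] [Module R M]
          (f : N →ₗ[R] M), Function.Injective f →
          ∀ g : N →ₗ[R] E, ∃ h : M →ₗ[R] E, h ∘ₗ f = g := by

  constructor
  · intro hR E _ _ hE hdiv N M _ _ _ _ f hf g
    have hinj : Module.Injective R E := module_injective_of_isPureWInjective hE
      fun M _ _ f hf L _ _ x hx => hR.isGVTorsionElem_of_lTensor_eq_zero hdiv hf hx
    obtain ⟨h, hh⟩ := hinj.out f hf g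
    exact ⟨h, LinearMap.ext hh⟩
  · intro H
    refine isPvMD_of_isPrincipal_map fun I hI p _ hp => ?_
    have hflat : Module.Flat R (I.map (algebraMap R (Localization.AtPrime p))) := by
      refine flat_of_forall_isPureWInjective_divisible (S := Localization.AtPrime p)
        (fun E _ _ hE hdiv => ⟨fun N M _ _ _ _ f hf g => ?_⟩) (fun J hJ => ?_) fun r hr x hx => ?_
      · obtain ⟨h, hh⟩ := H E hE hdiv N M f hf g
        exact ⟨h, LinearMap.congr_fun hh⟩
      · obtain ⟨j, hj, hjp⟩ := SetLike.not_le_iff_exists.1 (hp J hJ)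
        exact ⟨j, hj, IsLocalization.map_units _ (⟨j, hjp⟩ : p.primeCompl)⟩
      · have : algebraMap R (Localization.AtPrime p) r ≠ 0 := fun h =>
          hr (IsLocalization.injective _ p.primeCompl_le_nonZeroDivisors (h.trans (map_zero _).symm))
        rw [← algebraMap_smul (Localization.AtPrime p)] at hx
        exact (smul_eq_zero.1 hx).resolve_left this
    have : IsDomain (Localization.AtPrime p) :=
      IsLocalization.isDomain_localization p.primeCompl_le_nonZeroDivisors
    have := (Module.flat_iff_of_isLocalization (Localization.AtPrime p) p.primeCompl
      (I.map (algebraMap R (Localization.AtPrime p)))).2 hflat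
    exact Ideal.isPrincipal_of_flat_of_fg (hI.map _)
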